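/- Let 𝒜 be an infinite Boolean algebra with the subsequential separation property. Then 𝒜 contains an independent family of cardinality continuum, i.e. there exists an injective map x ↦ A_x from 2^ℕ into 𝒜 such that (A_x)_{x ∈ 2^ℕ} is independent. -/

import Mathlib

/-- A Boolean algebra has the *subsequential separation property* if for every injective
sequence of pairwise disjoint nonzero elements `(Aₙ)` there is an `a` such that
`{n | A_{2n} ≤ a ∧ A_{2n+1} ⊓ a = ⊥}` is infinite. -/
def SubseqSep (A : Type*) [BooleanAlgebra A] : Prop :=
  ∀ f : ℕ → A, Function.Injective f → (∀ n, f n ≠ ⊥) →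
    (∀ m n, m ≠ n → f m ⊓ f n = ⊥) →
    ∃ a : A, {n : ℕ | f (2 * n) ≤ a ∧ f (2 * n + 1) ⊓ a = ⊥}.Infinite

/-- A family `(gᵢ)` in a Boolean algebra is *independent* if for all disjoint finite
`F, G ⊆ I` the element `⨅_{i ∈ F} gᵢ ⊓ ⨅_{i ∈ G} gᵢᶜ` is nonzero. -/
def IndepFamily {I A : Type*} [BooleanAlgebra A] (g : I → A) : Prop :=
  ∀ F G : Finset I, Disjoint F G →
    (F.inf g ⊓ G.inf fun i => (g i)ᶜ) ≠ ⊥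

namespace SubseqSepAux

variable {A : Type*} [BooleanAlgebra A]

lemma shrink (c : A) (hc : (Set.Iic c).Infinite) :
    ∃ c' ≤ c, (Set.Iic c').Infinite ∧ c \ c' ≠ ⊥ := by
  obtain ⟨e, he, hne⟩ := (hc.sdiff (Set.toFinite {⊥, c})).nonempty
  simp only [Set.mem_insert_iff, Set.mem_singleton_iff, not_or] at hne
  have hec : e ≤ c := he
  by_cases h1 : (Set.Iic e).Infinite
  · refine ⟨e, hec, h1, fun h => hne.2 ?_⟩
    exact le_antisymm hec (sdiff_eq_bot_iff.1 h)
  · refine ⟨c \ e, sdiff_le, ?_, ?_⟩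
    · intro h2
      rw [Set.not_infinite] at h1
      apply hc
      refine ((h1.prod h2).image (fun p : A × A => p.1 ⊔ p.2)).subset ?_
      intro x hx
      refine ⟨(x ⊓ e, x \ e), ⟨inf_le_right, sdiff_le_sdiff_right hx⟩, ?_⟩
      simp
    · rw [sdiff_sdiff_right_self, inf_eq_right.2 hec]
      exact hne.1

lemma exists_disj_seq [Infinite A] :
    ∃ f : ℕ → A, (∀ n, f n ≠ ⊥) ∧ ∀ m n, m ≠ n → f m ⊓ f n = ⊥ := by
  choose! s hs1 hs2 hs3 using (shrink (A := A))
  let c : ℕ → A := fun n => s^[n] ⊤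
  have hsucc : ∀ n, c (n+1) = s (c n) := fun n => Function.iterate_succ_apply' _ _ _
  have hinf : ∀ n, (Set.Iic (c n)).Infinite := by
    intro n
    induction n with
    | zero => simpa [c] using Set.infinite_univ
    | succ n ih => rw [hsucc]; exact hs2 _ ih
  have hanti : Antitone c := antitone_nat_of_succ_le fun n => by
    rw [hsucc]; exact hs1 _ (hinf n)
  have key : ∀ m n, m < n → Disjoint (c m \ c (m+1)) (c n \ c (n+1)) := by
    intro m n hmn
    exact (disjoint_sdiff_self_left).mono_right (sdiff_le.trans (hanti hmn))
  refine ⟨fun n => c n \ c (n+1), fun n => ?_, fun m n hmn => ?_⟩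
  · simp only [hsucc]; exact hs3 _ (hinf n)
  · rcases lt_or_gt_of_ne hmn with h | h
    · exact (key m n h).eq_bot
    · exact (key n m h).symm.eq_bot

lemma disj_inj (f : ℕ → A) (h0 : ∀ n, f n ≠ ⊥) (hd : ∀ m n, m ≠ n → f m ⊓ f n = ⊥) :
    Function.Injective f := by
  intro m n hmn
  by_contra hne
  have := hd m n hne
  rw [hmn, inf_idem] at this
  exact h0 n this

lemma split (h : SubseqSep A) (f : ℕ → A) (h0 : ∀ n, f n ≠ ⊥)
    (hd : ∀ m n, m ≠ n → f m ⊓ f n = ⊥) (c : A) (hc : {n | f n ≤ c}.Infinite) :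
    ∃ a, {n | f n ≤ c ⊓ a}.Infinite ∧ {n | f n ≤ c \ a}.Infinite := by
  let e := hc.natEmbedding
  have hei : ∀ m n, (e m : ℕ) = e n → m = n := fun m n hh => e.injective (Subtype.ext hh)
  have he : ∀ n, f (e n) ≤ c := fun n => (e n).2
  have hd' : ∀ m n, m ≠ n → f (e m) ⊓ f (e n) = ⊥ :=
    fun m n hmn => hd _ _ fun hh => hmn (hei _ _ hh)
  obtain ⟨a, ha⟩ := h (fun n => f (e n))
    (disj_inj _ (fun n => h0 _) hd') (fun n => h0 _) hd'
  refine ⟨a, ?_, ?_⟩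
  · refine (ha.image (f := fun n => (e (2*n) : ℕ)) ?_).mono ?_
    · intro m _ n _ hh
      have := hei _ _ hh
      omega
    · rintro _ ⟨n, hn, rfl⟩
      exact le_inf (he _) hn.1
  · refine (ha.image (f := fun n => (e (2*n+1) : ℕ)) ?_).mono ?_
    · intro m _ n _ hh
      have := hei _ _ hh
      omega
    · rintro _ ⟨n, hn, rfl⟩
      exact le_sdiff.2 ⟨he _, disjoint_iff.2 hn.2⟩

def B (a : A → A) : ℕ → A → A
  | 0, c => c ⊓ a c
  | n+1, c => B a n (c ⊓ a c) ⊔ B a n (c \ a c)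

lemma B_le (a : A → A) (n : ℕ) (c : A) : B a n c ≤ c := by
  induction n generalizing c with
  | zero => exact inf_le_left
  | succ n ih => exact sup_le ((ih _).trans inf_le_left) ((ih _).trans sdiff_le)

lemma B_indep (a : A → A) (P : A → Prop) (hP : ∀ c, P c → P (c ⊓ a c) ∧ P (c \ a c))
    (n : ℕ) : ∀ (σ : ℕ → Prop) (c : A), P c →
    ∃ d ≤ c, P d ∧ ∀ i < n, (σ i → d ≤ B a i c) ∧ (¬ σ i → Disjoint d (B a i c)) := by
  induction n with
  | zero => intro σ c hc; exact ⟨c, le_rfl, hc, by simp⟩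
  | succ n ih =>
    intro σ c hc
    by_cases h0 : σ 0
    · obtain ⟨d, hd, hPd, hi⟩ := ih (fun i => σ (i+1)) _ (hP c hc).1
      refine ⟨d, hd.trans inf_le_left, hPd, ?_⟩
      rintro (_ | i) hin
      · exact ⟨fun _ => hd, fun hh => absurd h0 hh⟩
      · refine ⟨fun hh => ((hi i (by omega)).1 hh).trans le_sup_left, fun hh => ?_⟩
        refine ((hi i (by omega)).2 hh).sup_right ?_
        exact (disjoint_sdiff_self_right.mono_left inf_le_right).mono hd (B_le _ _ _)
    · obtain ⟨d, hd, hPd, hi⟩ := ih (fun i => σ (i+1)) _ (hP c hc).2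
      refine ⟨d, hd.trans sdiff_le, hPd, ?_⟩
      rintro (_ | i) hin
      · refine ⟨fun hh => absurd hh h0, fun _ => ?_⟩
        exact (disjoint_sdiff_self_left.mono_right inf_le_right).mono_left hd
      · refine ⟨fun hh => ((hi i (by omega)).1 hh).trans le_sup_right, fun hh => ?_⟩
        refine Disjoint.sup_right ?_ ((hi i (by omega)).2 hh)
        exact (disjoint_sdiff_self_left.mono_right inf_le_right).mono hd (B_le _ _ _)

lemma exists_indep_seq [Infinite A] (h : SubseqSep A) :
    ∃ b : ℕ → A, ∀ (s : Finset ℕ) (σ : ℕ → Prop),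
      ∃ d, d ≠ ⊥ ∧ ∀ i ∈ s, (σ i → d ≤ b i) ∧ (¬ σ i → Disjoint d (b i)) := by
  obtain ⟨f, h0, hd⟩ := exists_disj_seq (A := A)
  choose! a ha using split h f h0 hd
  refine ⟨fun n => B a n ⊤, fun s σ => ?_⟩
  obtain ⟨d, -, hP, hi⟩ := B_indep a (fun c => {n | f n ≤ c}.Infinite) ha (s.sup id + 1) σ ⊤
    (by simpa using Set.infinite_univ)
  refine ⟨d, ?_, fun i his => hi i (Nat.lt_succ_of_le (Finset.le_sup (f := id) his))⟩
  rintro rfl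
  obtain ⟨n, hn⟩ := hP.nonempty
  exact h0 n (le_bot_iff.1 hn)

/-- code of the restriction of `x` to `n`. -/
def u (x : ℕ → Bool) (n : ℕ) : ℕ := Encodable.encode ((List.range n).map x)

lemma u_eq {x y : ℕ → Bool} {m n : ℕ} (h : u x m = u y n) :
    m = n ∧ ∀ i < m, x i = y i := by
  have h1 := Encodable.encode_injective h
  have h2 : m = n := by simpa using congrArg List.length h1
  subst h2
  refine ⟨rfl, fun i hi => ?_⟩
  exact List.map_inj_left.1 h1 i (List.mem_range.2 hi)

lemma exists_sep (T : Finset (ℕ → Bool)) :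
    ∃ N, ∀ x ∈ T, ∀ y ∈ T, (∀ i < N, x i = y i) → x = y := by
  have : ∀ p : (ℕ → Bool) × (ℕ → Bool), ∃ N, (∀ i < N, p.1 i = p.2 i) → p.1 = p.2 := by
    intro p
    by_cases hp : p.1 = p.2
    · exact ⟨0, fun _ => hp⟩
    · obtain ⟨i, hi⟩ := Function.ne_iff.1 hp
      exact ⟨i+1, fun hh => absurd (hh i (Nat.lt_succ_self i)) hi⟩
  choose N hN using this
  refine ⟨(T ×ˢ T).sup N, fun x hx y hy hh => hN (x, y) fun i hi => hh i ?_⟩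
  exact lt_of_lt_of_le hi (Finset.le_sup (f := N) (Finset.mk_mem_product hx hy))

end SubseqSepAux

open SubseqSepAux in
/-- Any infinite Boolean algebra with the subsequential separation property contains
an independent family of cardinality continuum, indexed injectively by `2^ℕ`. -/
theorem indep_family_continuum_of_subseqSep (A : Type*) [BooleanAlgebra A] [Infinite A]
    (h : SubseqSep A) :
    ∃ g : (ℕ → Bool) → A, Function.Injective g ∧ IndepFamily g := by
  classical
  obtain ⟨b, hb⟩ := exists_indep_seq h
  let C : (ℕ → Bool) → ℕ → A := fun x n =>
    b (u x n) \ (Finset.range n).sup (fun j => b (u x j))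
  have hdC : ∀ (x : ℕ → Bool) (d : A) (n : ℕ), d ≤ b (u x n) →
      (∀ j < n, Disjoint d (b (u x j))) → d ≤ C x n := by
    intro x d n h1 h2
    refine le_sdiff.2 ⟨h1, ?_⟩
    rw [Finset.disjoint_sup_right]
    exact fun j hj => h2 j (Finset.mem_range.1 hj)
  have hC0 : ∀ x n, C x n ≠ ⊥ := by
    intro x n hbot
    obtain ⟨d, hd0, hd⟩ := hb ((Finset.range (n+1)).image (u x)) (fun i => i = u x n)
    apply hd0
    rw [← le_bot_iff, ← hbot]
    have hmem : ∀ j ≤ n, u x j ∈ (Finset.range (n+1)).image (u x) := fun j hj =>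
      Finset.mem_image_of_mem _ (Finset.mem_range.2 (by omega))
    refine hdC x d n ((hd _ (hmem n le_rfl)).1 rfl) fun j hj => (hd _ (hmem j hj.le)).2 ?_
    intro hh
    have := (u_eq hh).1
    omega
  have hCd' : ∀ x m n, m < n → Disjoint (C x m) (C x n) := by
    intro x m n hmn
    refine (disjoint_sdiff_self_right (y := b (u x n))).mono_left ?_
    exact sdiff_le.trans
      (Finset.le_sup (f := fun j => b (u x j)) (Finset.mem_range.2 hmn))
  have hCd : ∀ x m n, m ≠ n → C x m ⊓ C x n = ⊥ := by
    intro x m n hmn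
    rcases lt_or_gt_of_ne hmn with hh | hh
    · exact (hCd' x m n hh).eq_bot
    · exact (hCd' x n m hh).symm.eq_bot
  choose g hg using fun x => h (C x) (disj_inj _ (hC0 x) (hCd x)) (hC0 x) (hCd x)
  have hind : IndepFamily g := by
    intro F G hFG hbot
    obtain ⟨N, hN⟩ := exists_sep (F ∪ G)
    have hk : ∀ x, ∃ k, N ≤ k ∧ (x ∈ F → C x k ≤ g x) ∧ (x ∈ G → C x k ≤ (g x)ᶜ) := by
      intro x
      obtain ⟨n, hn, hNn⟩ := (hg x).exists_gt N
      by_cases hx : x ∈ F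
      · exact ⟨2*n, by omega, fun _ => hn.1,
          fun hx' => absurd hx' (Finset.disjoint_left.1 hFG hx)⟩
      · exact ⟨2*n+1, by omega, fun hx' => absurd hx' hx,
          fun _ => le_compl_iff_disjoint_right.2 (disjoint_iff.2 hn.2)⟩
    choose k hkN hkF hkG using hk
    obtain ⟨d, hd0, hd⟩ := hb
      ((F ∪ G).biUnion fun x => (Finset.range (k x + 1)).image (u x))
      (fun i => ∃ y ∈ F ∪ G, i = u y (k y))
    have hdx : ∀ x ∈ F ∪ G, d ≤ C x (k x) := by
      intro x hx
      have hmem : ∀ j ≤ k x, u x j ∈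
          (F ∪ G).biUnion fun x => (Finset.range (k x + 1)).image (u x) := fun j hj =>
        Finset.mem_biUnion.2 ⟨x, hx,
          Finset.mem_image_of_mem _ (Finset.mem_range.2 (by omega))⟩
      refine hdC x d _ ((hd _ (hmem _ le_rfl)).1 ⟨x, hx, rfl⟩) fun j hj =>
        (hd _ (hmem j hj.le)).2 ?_
      rintro ⟨y, hy, hxy⟩
      obtain ⟨h1, h2⟩ := u_eq hxy
      have h3 : x = y := hN x hx y hy fun i hi => h2 i (by have := hkN y; omega)
      subst h3
      omega
    apply hd0
    rw [← le_bot_iff, ← hbot]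
    refine le_inf (Finset.le_inf fun x hx => ?_) (Finset.le_inf fun x hx => ?_)
    · exact (hdx x (Finset.mem_union_left _ hx)).trans (hkF x hx)
    · exact (hdx x (Finset.mem_union_right _ hx)).trans (hkG x hx)
  refine ⟨g, fun x y hxy => ?_, hind⟩
  by_contra hne
  apply hind {x} {y} (by simpa using hne)
  simp [hxy]
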